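/- Let G be a finite simple graph, k a positive integer, and e an edge of G. If γ_{P,k}(G − e) = γ_{P,k}(G) + 1, then rad_{P,k}(G − e) ≤ rad_{P,k}(G), where G − e is the graph obtained from G by removing the edge e. -/

import Mathlib

open SimpleGraph

variable {V : Type*}

/-- The closed neighbourhood `N_G[v]` of a vertex. -/
def closedNbhd (G : SimpleGraph V) (v : V) : Set V := insert v (G.neighborSet v)

/-- The closed neighbourhood `N_G[X]` of a set of vertices. -/
def closedNbhdSet (G : SimpleGraph V) (X : Set V) : Set V := ⋃ v ∈ X, closedNbhd G v

/-- The sets `P^i_{G,k}(S)` of vertices monitored by `S` at step `i`. -/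
def monitored (G : SimpleGraph V) (k : ℕ) (S : Set V) : ℕ → Set V
  | 0 => closedNbhdSet G S
  | i + 1 =>
      ⋃ v ∈ {w | w ∈ monitored G k S i ∧ (closedNbhd G w \ monitored G k S i).ncard ≤ k},
        closedNbhd G v

/-- `S` is a `k`-power dominating set of `G`. -/
def IsPDS (G : SimpleGraph V) (k : ℕ) (S : Set V) : Prop :=
  ∃ i, monitored G k S i = Set.univ

/-- The `k`-power domination number `γ_{P,k}(G)`. -/
noncomputable def pdn (G : SimpleGraph V) (k : ℕ) : ℕ :=
  sInf {n | ∃ S : Set V, IsPDS G k S ∧ S.ncard = n}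

/-- The radius `rad_{P,k}(G,S)` of a `k`-PDS `S`. -/
noncomputable def radPDS (G : SimpleGraph V) (k : ℕ) (S : Set V) : ℕ :=
  1 + sInf {i | monitored G k S i = Set.univ}

/-- The `k`-propagation radius `rad_{P,k}(G)`. -/
noncomputable def propRad (G : SimpleGraph V) (k : ℕ) : ℕ :=
  sInf {r | ∃ S : Set V, IsPDS G k S ∧ S.ncard = pdn G k ∧ radPDS G k S = r}

lemma mem_closedNbhd {G : SimpleGraph V} {v w : V} : w ∈ closedNbhd G v ↔ w = v ∨ G.Adj v w :=
  Iff.rfl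

lemma closedNbhd_mono {G H : SimpleGraph V} (hGH : G ≤ H) (v : V) :
    closedNbhd G v ⊆ closedNbhd H v :=
  Set.insert_subset_insert fun _ hw => hGH hw

lemma closedNbhd_subset_monitored_zero (G : SimpleGraph V) (k : ℕ) {S : Set V} {v : V}
    (hv : v ∈ S) : closedNbhd G v ⊆ monitored G k S 0 :=
  Set.subset_biUnion_of_mem (u := closedNbhd G) hv

lemma mem_monitored_succ {G : SimpleGraph V} {k : ℕ} {S : Set V} {i : ℕ} {w : V} :
    w ∈ monitored G k S (i + 1) ↔ ∃ v, (v ∈ monitored G k S i ∧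
      (closedNbhd G v \ monitored G k S i).ncard ≤ k) ∧ w ∈ closedNbhd G v := by
  simp [monitored]

section Finite

variable [Finite V]

lemma monitored_subset_succ (G : SimpleGraph V) (k : ℕ) (S : Set V) (i : ℕ) :
    monitored G k S i ⊆ monitored G k S (i + 1) := by
  induction i with
  | zero =>
    intro w hw
    obtain ⟨v, hv, hwv⟩ := Set.mem_iUnion₂.1 hw
    have hsub := closedNbhd_subset_monitored_zero G k hv
    refine mem_monitored_succ.2 ⟨v, ⟨hsub (Set.mem_insert _ _), ?_⟩, hwv⟩
    simp [Set.sdiff_eq_empty.2 hsub]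
  | succ i ih =>
    intro w hw
    obtain ⟨v, ⟨hv, hcard⟩, hwv⟩ := mem_monitored_succ.1 hw
    exact mem_monitored_succ.2 ⟨v, ⟨ih hv,
      (Set.ncard_le_ncard (Set.sdiff_subset_sdiff_right ih) (Set.toFinite _)).trans hcard⟩, hwv⟩

lemma monitored_mono (G : SimpleGraph V) (k : ℕ) (S : Set V) : Monotone (monitored G k S) :=
  monotone_nat_of_le_succ (monitored_subset_succ G k S)

/-- Adding to `S` the endpoint of `e` that is monitored last makes up for deleting `e`. -/
lemma monitored_subset_monitored_deleteEdges_insert (G : SimpleGraph V) (k : ℕ) {S : Set V}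
    {x y : V} (hS : y ∈ S → x ∈ S)
    (hxy : ∀ i, y ∈ monitored G k S i → x ∈ monitored G k S i) (i : ℕ) :
    monitored G k S i ⊆ monitored (G.deleteEdges {s(x, y)}) k (insert y S) i := by
  set H := G.deleteEdges {s(x, y)} with hH
  have hHG : H ≤ G := G.deleteEdges_le _
  have split : ∀ {v w}, w ∈ closedNbhd G v →
      w ∈ closedNbhd H v ∨ (v = x ∧ w = y) ∨ (v = y ∧ w = x) := by
    intro v w hw
    by_cases hvw : s(v, w) = s(x, y)
    · exact Or.inr (Sym2.eq_iff.1 hvw)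
    · refine Or.inl ((mem_closedNbhd.1 hw).imp id fun h => ?_)
      exact SimpleGraph.deleteEdges_adj.2 ⟨h, hvw⟩
  have hy0 : closedNbhd H y ⊆ monitored H k (insert y S) 0 :=
    closedNbhd_subset_monitored_zero H k (Set.mem_insert _ _)
  have hy : ∀ j, y ∈ monitored H k (insert y S) j := fun j =>
    monitored_mono H k _ (Nat.zero_le j) (hy0 (Set.mem_insert _ _))
  induction i with
  | zero =>
    intro w hw
    obtain ⟨v, hv, hwv⟩ := Set.mem_iUnion₂.1 hw
    rcases split hwv with hwv | ⟨rfl, rfl⟩ | ⟨rfl, rfl⟩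
    · exact closedNbhd_subset_monitored_zero H k (Set.mem_insert_of_mem _ hv) hwv
    · exact hy 0
    · exact closedNbhd_subset_monitored_zero H k (Set.mem_insert_of_mem _ (hS hv))
        (Set.mem_insert _ _)
  | succ i ih =>
    intro w hw
    obtain ⟨v, ⟨hv, hcard⟩, hwv⟩ := mem_monitored_succ.1 hw
    rcases split hwv with hwv | ⟨rfl, rfl⟩ | ⟨rfl, rfl⟩
    · exact mem_monitored_succ.2 ⟨v, ⟨ih hv, (Set.ncard_le_ncard
        (Set.sdiff_subset_sdiff (closedNbhd_mono hHG v) ih) (Set.toFinite _)).trans hcard⟩, hwv⟩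
    · exact hy _
    · exact monitored_subset_succ H k _ i (ih (hxy i hv))

/-- For every edge `e` there is a vertex whose addition to `S` makes up for deleting `e`. -/
lemma exists_forall_monitored_subset_deleteEdges_insert (G : SimpleGraph V) (k : ℕ) (S : Set V)
    (e : Sym2 V) :
    ∃ z, ∀ i, monitored G k S i ⊆ monitored (G.deleteEdges {e}) k (insert z S) i := by
  induction e using Sym2.ind with
  | _ x y =>
  have mem_of_mem : ∀ {v}, v ∈ S → ∀ i, v ∈ monitored G k S i := fun hv i =>
    monitored_mono G k S (Nat.zero_le i)
      (closedNbhd_subset_monitored_zero G k hv (Set.mem_insert _ _))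
  have key : ((y ∈ S → x ∈ S) ∧ ∀ i, y ∈ monitored G k S i → x ∈ monitored G k S i) ∨
      ((x ∈ S → y ∈ S) ∧ ∀ i, x ∈ monitored G k S i → y ∈ monitored G k S i) := by
    by_cases hx : x ∈ S
    · exact Or.inl ⟨fun _ => hx, fun i _ => mem_of_mem hx i⟩
    by_cases hy : y ∈ S
    · exact Or.inr ⟨fun _ => hy, fun i _ => mem_of_mem hy i⟩
    by_cases hlast : ∀ i, y ∈ monitored G k S i → x ∈ monitored G k S i
    · exact Or.inl ⟨fun h => absurd h hy, hlast⟩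
    push Not at hlast
    obtain ⟨j, hyj, hxj⟩ := hlast
    refine Or.inr ⟨fun h => absurd h hx, fun i hxi => ?_⟩
    rcases le_total i j with hij | hji
    · exact absurd (monitored_mono G k S hij hxi) hxj
    · exact monitored_mono G k S hji hyj
  rcases key with ⟨hS, hxy⟩ | ⟨hS, hxy⟩
  · exact ⟨y, monitored_subset_monitored_deleteEdges_insert G k hS hxy⟩
  · rw [Sym2.eq_swap]
    exact ⟨x, monitored_subset_monitored_deleteEdges_insert G k hS hxy⟩

end Finite

lemma isPDS_univ (G : SimpleGraph V) (k : ℕ) : IsPDS G k Set.univ :=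
  ⟨0, Set.eq_univ_of_forall fun v =>
    closedNbhd_subset_monitored_zero G k (Set.mem_univ v) (Set.mem_insert _ _)⟩

lemma pdn_le_ncard {G : SimpleGraph V} {k : ℕ} {S : Set V} (hS : IsPDS G k S) :
    pdn G k ≤ S.ncard :=
  Nat.sInf_le ⟨S, hS, rfl⟩

lemma exists_isPDS_ncard_eq_pdn_radPDS_eq_propRad (G : SimpleGraph V) (k : ℕ) :
    ∃ S, IsPDS G k S ∧ S.ncard = pdn G k ∧ radPDS G k S = propRad G k := by
  obtain ⟨S, hS, hcard⟩ := Nat.sInf_mem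
    (s := {n | ∃ S : Set V, IsPDS G k S ∧ S.ncard = n}) ⟨_, _, isPDS_univ G k, rfl⟩
  exact Nat.sInf_mem
    (s := {r | ∃ S : Set V, IsPDS G k S ∧ S.ncard = pdn G k ∧ radPDS G k S = r})
    ⟨_, S, hS, hcard, rfl⟩

theorem propRad_edge_deletion_increase {V : Type*} [Fintype V]
    (G : SimpleGraph V) (k : ℕ) (hk : 0 < k) (e : Sym2 V) (he : e ∈ G.edgeSet)
    (h : pdn (G.deleteEdges {e}) k = pdn G k + 1) :
    propRad (G.deleteEdges {e}) k ≤ propRad G k := by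
  obtain ⟨S, ⟨i, hi⟩, hcard, hrad⟩ := exists_isPDS_ncard_eq_pdn_radPDS_eq_propRad G k
  obtain ⟨z, hz⟩ := exists_forall_monitored_subset_deleteEdges_insert G k S e
  have univ_of_univ : ∀ j, monitored G k S j = Set.univ →
      monitored (G.deleteEdges {e}) k (insert z S) j = Set.univ := fun j hj =>
    Set.univ_subset_iff.1 (hj ▸ hz j)
  have hPDS : IsPDS (G.deleteEdges {e}) k (insert z S) := ⟨i, univ_of_univ i hi⟩
  have hcard' : (insert z S).ncard = pdn (G.deleteEdges {e}) k := by
    have hle := pdn_le_ncard hPDS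
    have hins := Set.ncard_insert_le z S
    omega
  calc propRad (G.deleteEdges {e}) k
      ≤ radPDS (G.deleteEdges {e}) k (insert z S) := Nat.sInf_le ⟨_, hPDS, hcard', rfl⟩
    _ ≤ radPDS G k S := Nat.add_le_add_left
        (Nat.sInf_le (univ_of_univ _ (Nat.sInf_mem (s := {i | monitored G k S i = Set.univ}) ⟨i, hi⟩))) 1
    _ = propRad G k := hrad
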